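/- arXiv:1406.1956 — 2 statements merged into one kernel-verified Lean document; each statement's English description precedes it below -/
import Mathlib

section
/- Let H ∈ (0,1), let (Ω, F, P) be a probability space and let X : [0,∞) × Ω → ℝ be a stochastic process (each X_t measurable) such that for all s, t ≥ 0 the law of X_t − X_s under P is the Gaussian measure on ℝ with mean 0 and variance |t−s|^{2H}. Then for every γ ∈ (0, H) there exists a process Y : [0,∞) × Ω → ℝ with P(X_t = Y_t) = 1 for every t ≥ 0, such that every sample path of Y is continuous and is γ-Hölder continuous on [0,T] for every T > 0. -/
open Real MeasureTheory ProbabilityTheory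

open Filter Topology
open scoped ENNReal

/-- The largest multiple of `2⁻ⁿ` that is at most `t`, for `t ≥ 0`. -/
noncomputable def dyadicFloor (n : ℕ) (t : ℝ) : ℝ := (⌊t * 2 ^ n⌋₊ : ℝ) / 2 ^ n

lemma dyadicFloor_nonneg (n : ℕ) (t : ℝ) : 0 ≤ dyadicFloor n t := by
  unfold dyadicFloor; positivity

lemma abs_sub_dyadicFloor_le (n : ℕ) {t : ℝ} (ht : 0 ≤ t) :
    |t - dyadicFloor n t| ≤ (1 / 2) ^ n := by
  have h2 : (0 : ℝ) < 2 ^ n := by positivity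
  have h1 := Nat.floor_le (mul_nonneg ht h2.le)
  have h3 := Nat.lt_floor_add_one (t * 2 ^ n)
  have h4 : t - dyadicFloor n t = (t * 2 ^ n - ⌊t * 2 ^ n⌋₊) / 2 ^ n := by
    unfold dyadicFloor; field_simp
  rw [h4, one_div, inv_pow, abs_of_nonneg (div_nonneg (by linarith) h2.le), inv_eq_one_div]
  gcongr
  linarith

/-- The increments of `f` between neighbouring multiples of `2⁻ⁿ` in `[0, 2ⁿ]` are at most `rⁿ`
for all large `n`. -/
def DyadicIncrementsLE (r : ℝ) (f : ℝ → ℝ) : Prop :=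
  ∀ᶠ n : ℕ in atTop, ∀ k < 4 ^ n, |f ((k + 1 : ℕ) / 2 ^ n) - f ((k : ℕ) / 2 ^ n)| ≤ r ^ n

section Deterministic

variable {r : ℝ} {f : ℝ → ℝ} {n : ℕ}

lemma abs_dyadicFloor_succ_sub_le (hr : 0 ≤ r)
    (h : ∀ k < 4 ^ (n + 1),
      |f ((k + 1 : ℕ) / 2 ^ (n + 1)) - f ((k : ℕ) / 2 ^ (n + 1))| ≤ r ^ (n + 1))
    {t : ℝ} (ht : 0 ≤ t) (htn : t < 2 ^ n) :
    |f (dyadicFloor n t) - f (dyadicFloor (n + 1) t)| ≤ r ^ (n + 1) := by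
  have h2 : (0 : ℝ) < 2 ^ n := by positivity
  have hx : 0 ≤ t * 2 ^ n := mul_nonneg ht h2.le
  have h1 := Nat.floor_le hx
  have h3 := Nat.lt_floor_add_one (t * 2 ^ n)
  have hd : dyadicFloor n t = ((2 * ⌊t * 2 ^ n⌋₊ : ℕ) : ℝ) / 2 ^ (n + 1) := by
    unfold dyadicFloor; push_cast; rw [pow_succ]; field_simp
  have hlt : 2 * ⌊t * 2 ^ n⌋₊ < 4 ^ (n + 1) := by
    have : ⌊t * 2 ^ n⌋₊ < 4 ^ n := by
      rw [Nat.floor_lt hx]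
      push_cast
      rw [show (4 : ℝ) ^ n = 2 ^ n * 2 ^ n by rw [← mul_pow]; norm_num]
      gcongr
    rw [pow_succ]; omega
  have hcase : ⌊t * 2 ^ (n + 1)⌋₊ = 2 * ⌊t * 2 ^ n⌋₊ ∨
      ⌊t * 2 ^ (n + 1)⌋₊ = 2 * ⌊t * 2 ^ n⌋₊ + 1 := by
    have ha : 2 * ⌊t * 2 ^ n⌋₊ ≤ ⌊t * 2 ^ (n + 1)⌋₊ := by
      apply Nat.le_floor; push_cast; rw [pow_succ]; linarith
    have hb : ⌊t * 2 ^ (n + 1)⌋₊ < 2 * ⌊t * 2 ^ n⌋₊ + 2 := by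
      rw [Nat.floor_lt (by positivity)]; push_cast; rw [pow_succ]; linarith
    omega
  rw [hd, dyadicFloor]
  rcases hcase with hc | hc <;> rw [hc]
  · simpa using pow_nonneg hr (n + 1)
  · rw [abs_sub_comm]; exact h _ hlt

lemma abs_dyadicFloor_sub_le (hr : 0 ≤ r)
    (h : ∀ k < 4 ^ n, |f ((k + 1 : ℕ) / 2 ^ n) - f ((k : ℕ) / 2 ^ n)| ≤ r ^ n)
    {s t : ℝ} (hs : 0 ≤ s) (hst : s ≤ t) (htn : t < 2 ^ n) (hd : t - s ≤ (1 / 2) ^ n) :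
    |f (dyadicFloor n t) - f (dyadicFloor n s)| ≤ r ^ n := by
  have h2 : (0 : ℝ) < 2 ^ n := by positivity
  have hx : 0 ≤ s * 2 ^ n := mul_nonneg hs h2.le
  have h1 := Nat.floor_le hx
  have h3 := Nat.lt_floor_add_one (s * 2 ^ n)
  have hlt : ⌊s * 2 ^ n⌋₊ < 4 ^ n := by
    rw [Nat.floor_lt hx]
    push_cast
    rw [show (4 : ℝ) ^ n = 2 ^ n * 2 ^ n by rw [← mul_pow]; norm_num]
    gcongr
    linarith
  have hle : t * 2 ^ n ≤ s * 2 ^ n + 1 := by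
    have : (t - s) * 2 ^ n ≤ (1 / 2) ^ n * 2 ^ n := by gcongr
    rw [← mul_pow] at this
    norm_num at this
    linarith
  have hcase : ⌊t * 2 ^ n⌋₊ = ⌊s * 2 ^ n⌋₊ ∨ ⌊t * 2 ^ n⌋₊ = ⌊s * 2 ^ n⌋₊ + 1 := by
    have ha : ⌊s * 2 ^ n⌋₊ ≤ ⌊t * 2 ^ n⌋₊ := Nat.floor_mono (by gcongr)
    have hb : ⌊t * 2 ^ n⌋₊ < ⌊s * 2 ^ n⌋₊ + 2 := by
      rw [Nat.floor_lt (hx.trans (by gcongr))]; push_cast; linarith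
    omega
  unfold dyadicFloor
  rcases hcase with hc | hc <;> rw [hc]
  · simpa using pow_nonneg hr n
  · exact h _ hlt

lemma bddOn_comp_dyadicFloor (f : ℝ → ℝ) (n : ℕ) (T : ℝ) :
    ∃ M, ∀ t ≤ T, |f (dyadicFloor n t)| ≤ M := by
  refine ⟨∑ k ∈ Finset.range (⌊T * 2 ^ n⌋₊ + 1), |f ((k : ℝ) / 2 ^ n)|, fun t ht => ?_⟩
  refine Finset.single_le_sum (f := fun k : ℕ => |f ((k : ℝ) / 2 ^ n)|)
    (fun _ _ => abs_nonneg _) (Finset.mem_range.2 (Nat.lt_succ_of_le (Nat.floor_mono ?_)))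
  gcongr

/-- A level from which on the dyadic approximations of points of `[0, T]` are controlled. -/
lemma DyadicIncrementsLE.exists_level (h : DyadicIncrementsLE r f) (T : ℝ) :
    ∃ N, ∀ n ≥ N, T < 2 ^ n ∧
      ∀ k < 4 ^ n, |f ((k + 1 : ℕ) / 2 ^ n) - f ((k : ℕ) / 2 ^ n)| ≤ r ^ n :=
  eventually_atTop.1 <|
    ((tendsto_pow_atTop_atTop_of_one_lt (one_lt_two (α := ℝ))).eventually_gt_atTop T).and h

/-- The limit of a function along the dyadic approximations of a point. -/
noncomputable def dyadicLimit (f : ℝ → ℝ) (t : ℝ) : ℝ :=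
  limUnder atTop fun n => f (dyadicFloor n t)

lemma dist_dyadicFloor_le_geometric (hr : 0 ≤ r) (hr1 : r < 1) {N : ℕ} {t : ℝ} (ht : 0 ≤ t)
    (hN : ∀ n ≥ N, t < 2 ^ n ∧
      ∀ k < 4 ^ n, |f ((k + 1 : ℕ) / 2 ^ n) - f ((k : ℕ) / 2 ^ n)| ≤ r ^ n)
    (hn : N ≤ n) (k : ℕ) :
    dist (f (dyadicFloor (k + n) t)) (f (dyadicFloor (k + 1 + n) t)) ≤ r ^ n * r ^ k := by
  have h := abs_dyadicFloor_succ_sub_le hr (hN (k + n + 1) (by omega)).2 ht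
    (hN (k + n) (by omega)).1
  rw [show k + n + 1 = k + 1 + n by omega] at h
  rw [Real.dist_eq, ← pow_add]
  exact h.trans (pow_le_pow_of_le_one hr hr1.le (by omega))

lemma DyadicIncrementsLE.tendsto_dyadicLimit (h : DyadicIncrementsLE r f) (hr : 0 ≤ r)
    (hr1 : r < 1) {t : ℝ} (ht : 0 ≤ t) :
    Tendsto (fun n => f (dyadicFloor n t)) atTop (𝓝 (dyadicLimit f t)) := by
  obtain ⟨N, hN⟩ := h.exists_level t
  obtain ⟨a, ha⟩ := cauchySeq_tendsto_of_complete <|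
    cauchySeq_of_le_geometric r (r ^ N) hr1
      (dist_dyadicFloor_le_geometric hr hr1 ht hN le_rfl)
  exact tendsto_nhds_limUnder
    ⟨a, (tendsto_add_atTop_iff_nat (f := fun n => f (dyadicFloor n t)) N).1 ha⟩

lemma DyadicIncrementsLE.abs_sub_dyadicLimit_le (h : DyadicIncrementsLE r f) (hr : 0 ≤ r)
    (hr1 : r < 1) {N : ℕ} {t : ℝ} (ht : 0 ≤ t)
    (hN : ∀ n ≥ N, t < 2 ^ n ∧
      ∀ k < 4 ^ n, |f ((k + 1 : ℕ) / 2 ^ n) - f ((k : ℕ) / 2 ^ n)| ≤ r ^ n)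
    (hn : N ≤ n) :
    |f (dyadicFloor n t) - dyadicLimit f t| ≤ r ^ n / (1 - r) := by
  have := dist_le_of_le_geometric_of_tendsto₀ r (r ^ n) hr1
    (dist_dyadicFloor_le_geometric hr hr1 ht hN hn)
    ((tendsto_add_atTop_iff_nat (f := fun n => f (dyadicFloor n t)) n).2
      (h.tendsto_dyadicLimit hr hr1 ht))
  simpa [Real.dist_eq] using this

theorem DyadicIncrementsLE.exists_holder {γ : ℝ} (hγ : 0 < γ)
    (h : DyadicIncrementsLE ((1 / 2) ^ γ) f) (T : ℝ) :
    ∃ C, ∀ s t : ℝ, 0 ≤ s → s < t → t ≤ T →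
      |dyadicLimit f t - dyadicLimit f s| ≤ C * (t - s) ^ γ := by
  set r : ℝ := (1 / 2) ^ γ with hrdef
  have hr : 0 < r := by positivity
  have hr1 : r < 1 := Real.rpow_lt_one (by norm_num) (by norm_num) hγ
  have hrpow (n : ℕ) : (((1 : ℝ) / 2) ^ n) ^ γ = r ^ n := by
    rw [hrdef, ← Real.rpow_natCast, ← Real.rpow_natCast, ← Real.rpow_mul (by norm_num),
      ← Real.rpow_mul (by norm_num), mul_comm]
  obtain ⟨N, hN⟩ := h.exists_level T
  obtain ⟨M, hM⟩ := bddOn_comp_dyadicFloor f N T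
  have hlim {t : ℝ} (ht : 0 ≤ t) (htT : t ≤ T) {n : ℕ} (hn : N ≤ n) :
      |f (dyadicFloor n t) - dyadicLimit f t| ≤ r ^ n / (1 - r) :=
    h.abs_sub_dyadicLimit_le hr.le hr1 ht
      (fun n hn => ⟨htT.trans_lt (hN n hn).1, (hN n hn).2⟩) hn
  set K := 1 / (1 - r) with hK
  have hK0 : 0 < K := by rw [hK]; exact one_div_pos.2 (by linarith)
  set C₁ := (2 * K + 1) / r
  set C₂ := 2 * (M + K * r ^ N) / r ^ N
  refine ⟨max C₁ C₂, fun s t hs hst htT => ?_⟩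
  have hsT : s ≤ T := hst.le.trans htT
  have hpos : 0 < t - s := sub_pos.2 hst
  have hp0 : 0 ≤ (t - s) ^ γ := Real.rpow_nonneg hpos.le γ
  have hM0 : 0 ≤ M := (abs_nonneg _).trans (hM t htT)
  rcases le_or_gt ((1 / 2 : ℝ) ^ N) (t - s) with hbig | hsmall
  · refine le_trans ?_ (mul_le_mul_of_nonneg_right (le_max_right C₁ C₂) hp0)
    have hle : r ^ N ≤ (t - s) ^ γ := by
      rw [← hrpow]; exact Real.rpow_le_rpow (by positivity) hbig hγ.le
    have h1 := abs_le.1 (hlim (hs.trans hst.le) htT le_rfl)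
    have h2 := abs_le.1 (hlim hs hsT le_rfl)
    have h3 := abs_le.1 (hM t htT)
    have h4 := abs_le.1 (hM s hsT)
    have h5 : r ^ N / (1 - r) = K * r ^ N := by rw [hK]; ring
    rw [h5] at h1 h2
    have h6 : |dyadicLimit f t - dyadicLimit f s| ≤ 2 * (M + K * r ^ N) :=
      abs_le.2 ⟨by linarith [h1.1, h1.2], by linarith [h1.1, h1.2]⟩
    refine h6.trans ?_
    calc 2 * (M + K * r ^ N) = C₂ * r ^ N := by simp only [C₂]; field_simp
      _ ≤ C₂ * (t - s) ^ γ := by gcongr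
  · refine le_trans ?_ (mul_le_mul_of_nonneg_right (le_max_left C₁ C₂) hp0)
    have hle1 : t - s ≤ 1 := hsmall.le.trans (pow_le_one₀ (by norm_num) (by norm_num))
    obtain ⟨n, hn1, hn2⟩ := exists_nat_pow_near_of_lt_one hpos hle1
      (by norm_num : (0 : ℝ) < 1 / 2) (by norm_num)
    have hNn : N ≤ n := by
      by_contra! hlt
      have : (1 / 2 : ℝ) ^ N ≤ (1 / 2) ^ (n + 1) :=
        pow_le_pow_of_le_one (by norm_num) (by norm_num) hlt
      linarith
    have hle : r ^ (n + 1) ≤ (t - s) ^ γ := by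
      rw [← hrpow]; exact Real.rpow_le_rpow (by positivity) hn1.le hγ.le
    have h1 := abs_le.1 (hlim (hs.trans hst.le) htT hNn)
    have h2 := abs_le.1 (hlim hs hsT hNn)
    have h3 := abs_le.1 (abs_dyadicFloor_sub_le hr.le (hN n hNn).2 hs hst.le
      (htT.trans_lt (hN n hNn).1) hn2)
    have h5 : r ^ n / (1 - r) = K * r ^ n := by rw [hK]; ring
    rw [h5] at h1 h2
    have h6 : |dyadicLimit f t - dyadicLimit f s| ≤ (2 * K + 1) * r ^ n :=
      abs_le.2 ⟨by linarith [h1.1, h1.2], by linarith [h1.1, h1.2]⟩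
    refine h6.trans ?_
    calc (2 * K + 1) * r ^ n = C₁ * r ^ (n + 1) := by simp only [C₁, pow_succ]; field_simp
      _ ≤ C₁ * (t - s) ^ γ := by gcongr

lemma continuousOn_Ici_of_holder {g : ℝ → ℝ} {γ : ℝ} (hγ : 0 < γ)
    (h : ∀ T : ℝ, 0 < T → ∃ C : ℝ, ∀ s t : ℝ, 0 ≤ s → s < t → t ≤ T →
      |g t - g s| ≤ C * (t - s) ^ γ) :
    ContinuousOn g (Set.Ici 0) := by
  intro x hx
  obtain ⟨C, hC⟩ := h (x + 1) (by linarith [Set.mem_Ici.1 hx])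
  have hbound : ∀ᶠ y in 𝓝[Set.Ici 0] x, dist (g y) (g x) ≤ C * |y - x| ^ γ := by
    filter_upwards [self_mem_nhdsWithin, mem_nhdsWithin_of_mem_nhds (Iio_mem_nhds (lt_add_one x))]
      with y hy hy1
    rw [Real.dist_eq]
    rcases lt_trichotomy x y with hxy | rfl | hxy
    · rw [abs_of_pos (sub_pos.2 hxy)]
      exact hC x y hx hxy (le_of_lt hy1)
    · simp [Real.zero_rpow hγ.ne']
    · rw [abs_sub_comm, abs_sub_comm y, abs_of_pos (sub_pos.2 hxy)]
      exact hC y x hy hxy (by linarith)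
  refine tendsto_iff_dist_tendsto_zero.2 (squeeze_zero' (.of_forall fun _ => dist_nonneg) hbound ?_)
  have hcont : ContinuousAt (fun y : ℝ => C * |y - x| ^ γ) x :=
    continuousAt_const.mul (ContinuousAt.rpow_const (by fun_prop) (Or.inr hγ.le))
  have := hcont.tendsto.mono_left (nhdsWithin_le_nhds (s := Set.Ici 0))
  simpa [Real.zero_rpow hγ.ne'] using this

end Deterministic

lemma exists_gaussianReal_tail_le (q : ℝ) (hq : 0 < q) :
    ∃ c : ℝ≥0∞, c ≠ ∞ ∧ ∀ a : ℝ, 0 < a →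
      gaussianReal 0 1 {x | a ≤ |x|} ≤ c * ENNReal.ofReal (a ^ (-q)) := by
  have hq' : ENNReal.ofReal q ≠ 0 := by simpa using hq
  refine ⟨eLpNorm id (ENNReal.ofReal q) (gaussianReal 0 1) ^ q, ?_, fun a ha => ?_⟩
  · exact ENNReal.rpow_ne_top_of_nonneg hq.le
      (memLp_id_gaussianReal' (μ := 0) (v := 1) _ ENNReal.ofReal_ne_top).eLpNorm_ne_top
  · have := meas_ge_le_mul_pow_eLpNorm_enorm (gaussianReal 0 1) hq' ENNReal.ofReal_ne_top
      (f := id) aestronglyMeasurable_id (ε := ENNReal.ofReal a) (by simpa using ha) (by simp)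
    rw [ENNReal.toReal_ofReal hq.le] at this
    rw [Real.rpow_neg ha.le, ← Real.inv_rpow ha.le,
      ← ENNReal.ofReal_rpow_of_nonneg (by positivity) hq.le, ENNReal.ofReal_inv_of_pos ha, mul_comm]
    refine le_trans (measure_mono fun x hx => ?_) this
    simp only [Set.mem_ofPred_eq, id, Real.enorm_eq_ofReal_abs] at hx ⊢
    exact ENNReal.ofReal_le_ofReal hx

lemma exists_dyadic_tail_le {Ω : Type*} [MeasurableSpace Ω] (P : Measure Ω)
    {H : ℝ} (hH : 0 < H) {X : ℝ → Ω → ℝ} (hX : ∀ t : ℝ, Measurable (X t))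
    (hlaw : ∀ s t : ℝ, 0 ≤ s → 0 ≤ t →
      P.map (fun ω => X t ω - X s ω) =
        gaussianReal 0 (Real.toNNReal (|t - s| ^ (2*H))))
    {γ : ℝ} (hγ : γ < H) :
    ∃ c : ℝ≥0∞, c ≠ ∞ ∧ ∀ (n : ℕ) (s t : ℝ), 0 ≤ s → 0 ≤ t → |t - s| ≤ (1 / 2) ^ n →
      P {ω | (((1 : ℝ) / 2) ^ γ) ^ n < |X t ω - X s ω|} ≤ c * (8⁻¹) ^ n := by
  have hd : 0 < H - γ := sub_pos.2 hγ
  obtain ⟨c, hc, hcb⟩ := exists_gaussianReal_tail_le (3 / (H - γ)) (by positivity)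
  refine ⟨c, hc, fun n s t hs ht hst => ?_⟩
  set σ := |t - s| ^ H with hσ
  have hσ0 : 0 ≤ σ := by positivity
  have hgauss : gaussianReal 0 (Real.toNNReal (|t - s| ^ (2 * H))) =
      (gaussianReal 0 1).map (σ * ·) := by
    rw [gaussianReal_map_const_mul]
    congr 1
    · simp
    · ext
      rw [Real.coe_toNNReal _ (by positivity)]
      simp only [mul_one, NNReal.coe_mk]
      rw [hσ, mul_comm 2 H, Real.rpow_mul (abs_nonneg _), Real.rpow_two]
  have hset : MeasurableSet {x : ℝ | (((1 : ℝ) / 2) ^ γ) ^ n < |x|} :=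
    measurableSet_lt measurable_const measurable_norm
  have h1 : P {ω | (((1 : ℝ) / 2) ^ γ) ^ n < |X t ω - X s ω|} =
      gaussianReal 0 1 {x | (((1 : ℝ) / 2) ^ γ) ^ n < |σ * x|} := by
    have := congrArg (fun ν => ν {x : ℝ | (((1 : ℝ) / 2) ^ γ) ^ n < |x|})
      ((hlaw s t hs ht).trans hgauss)
    rwa [Measure.map_apply (by fun_prop) hset,
      Measure.map_apply (measurable_const_mul σ) hset] at this
  have hhalf (x : ℝ) : (((1 : ℝ) / 2) ^ n) ^ x = (((1 : ℝ) / 2) ^ x) ^ n := by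
    rw [← Real.rpow_natCast, ← Real.rpow_natCast, ← Real.rpow_mul (by norm_num),
      ← Real.rpow_mul (by norm_num), mul_comm]
  have hσle : σ ≤ (((1 : ℝ) / 2) ^ n) ^ H := Real.rpow_le_rpow (abs_nonneg _) hst hH.le
  have hb : (0 : ℝ) < (1 / 2) ^ n := by positivity
  rw [h1]
  refine (measure_mono (t := {x | (((1 : ℝ) / 2) ^ n) ^ (γ - H) ≤ |x|}) fun x hx => ?_).trans
    ((hcb _ (by positivity)).trans_eq ?_)
  · simp only [Set.mem_ofPred_eq, abs_mul, abs_of_nonneg hσ0, ← hhalf] at hx ⊢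
    rw [Real.rpow_sub hb, div_le_iff₀ (by positivity), mul_comm]
    exact hx.le.trans (by gcongr)
  · rw [← Real.rpow_mul hb.le, show (γ - H) * -(3 / (H - γ)) = (3 : ℕ) by
      push_cast; field_simp; ring, Real.rpow_natCast, ← pow_mul, mul_comm n, pow_mul,
      ENNReal.ofReal_pow (by norm_num)]
    congr 2
    rw [show ((1 : ℝ) / 2) ^ 3 = 8⁻¹ by norm_num, ENNReal.ofReal_inv_of_pos (by norm_num)]
    norm_num

lemma ae_eventually_notMem_of_le_geometric {Ω : Type*} [MeasurableSpace Ω] {P : Measure Ω}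
    {A : ℕ → Set Ω} {c : ℝ≥0∞} (hc : c ≠ ∞) (hA : ∀ n, P (A n) ≤ c * 2⁻¹ ^ n) :
    ∀ᵐ ω ∂P, ∀ᶠ n in atTop, ω ∉ A n := by
  refine ae_eventually_notMem (ne_top_of_le_ne_top ?_ (ENNReal.tsum_le_tsum hA))
  rw [ENNReal.tsum_mul_left, ENNReal.tsum_geometric]
  exact ENNReal.mul_ne_top hc (by simp)

lemma ae_dyadicIncrementsLE {Ω : Type*} [MeasurableSpace Ω] {P : Measure Ω} {X : ℝ → Ω → ℝ}
    {r : ℝ} {c : ℝ≥0∞} (hc : c ≠ ∞)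
    (hcb : ∀ (n : ℕ) (s t : ℝ), 0 ≤ s → 0 ≤ t → |t - s| ≤ (1 / 2) ^ n →
      P {ω | r ^ n < |X t ω - X s ω|} ≤ c * (8⁻¹) ^ n) :
    ∀ᵐ ω ∂P, DyadicIncrementsLE r (fun t => X t ω) := by
  have hA (n : ℕ) : P (⋃ k ∈ Finset.range (4 ^ n),
      {ω | r ^ n < |X ((k + 1 : ℕ) / 2 ^ n) ω - X ((k : ℕ) / 2 ^ n) ω|}) ≤ c * 2⁻¹ ^ n := by
    refine (measure_biUnion_finset_le _ _).trans ((Finset.sum_le_card_nsmul _ _ (c * (8⁻¹) ^ n)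
      fun k _ => hcb n _ _ (by positivity) (by positivity) ?_).trans_eq ?_)
    · rw [← sub_div, Nat.cast_succ, add_sub_cancel_left, abs_of_nonneg (by positivity),
        one_div_pow]
    · rw [Finset.card_range, nsmul_eq_mul, mul_left_comm]
      push_cast
      rw [← mul_pow]
      congr 2
      rw [show (8 : ℝ≥0∞) = 4 * 2 by norm_num, ENNReal.mul_inv (by simp) (by simp), ← mul_assoc,
        ENNReal.mul_inv_cancel (by simp) (by simp), one_mul]
  filter_upwards [ae_eventually_notMem_of_le_geometric hc hA] with ω hω
  filter_upwards [hω] with n hn k hk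
  simp only [Set.mem_iUnion, Finset.mem_range, Set.mem_ofPred_eq, not_exists, not_lt] at hn
  exact hn k hk

lemma ae_tendsto_dyadicFloor {Ω : Type*} [MeasurableSpace Ω] {P : Measure Ω} {X : ℝ → Ω → ℝ}
    {r : ℝ} (hr : 0 ≤ r) (hr1 : r < 1) {c : ℝ≥0∞} (hc : c ≠ ∞)
    (hcb : ∀ (n : ℕ) (s t : ℝ), 0 ≤ s → 0 ≤ t → |t - s| ≤ (1 / 2) ^ n →
      P {ω | r ^ n < |X t ω - X s ω|} ≤ c * (8⁻¹) ^ n) {t : ℝ} (ht : 0 ≤ t) :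
    ∀ᵐ ω ∂P, Tendsto (fun n => X (dyadicFloor n t) ω) atTop (𝓝 (X t ω)) := by
  have hA (n : ℕ) : P {ω | r ^ n < |X t ω - X (dyadicFloor n t) ω|} ≤ c * 2⁻¹ ^ n := by
    refine (hcb n _ t (dyadicFloor_nonneg n t) ht (abs_sub_dyadicFloor_le n ht)).trans ?_
    gcongr
    norm_num
  filter_upwards [ae_eventually_notMem_of_le_geometric hc hA] with ω hω
  refine tendsto_iff_dist_tendsto_zero.2 (squeeze_zero' (.of_forall fun _ => dist_nonneg) ?_
    (tendsto_pow_atTop_nhds_zero_of_lt_one hr hr1))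
  filter_upwards [hω] with n hn
  rw [dist_comm, Real.dist_eq]
  exact not_lt.1 hn

/-- Kolmogorov–Chentsov continuity for fractional Brownian motion: a process whose
increments `X_t - X_s` are centered Gaussian with variance `|t-s|^(2H)` admits a
modification all of whose sample paths are continuous on `[0,∞)` and `γ`-Hölder
continuous on every interval `[0,T]`, for each `γ ∈ (0,H)`. -/
theorem fbm_has_holder_continuous_modification
    {Ω : Type*} [MeasurableSpace Ω] (P : Measure Ω) [IsProbabilityMeasure P]
    (H : ℝ) (hH : H ∈ Set.Ioo (0:ℝ) 1)
    (X : ℝ → Ω → ℝ) (hX : ∀ t : ℝ, Measurable (X t))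
    (hlaw : ∀ s t : ℝ, 0 ≤ s → 0 ≤ t →
      P.map (fun ω => X t ω - X s ω) =
        gaussianReal 0 (Real.toNNReal (|t - s| ^ (2*H))))
    (γ : ℝ) (hγ : γ ∈ Set.Ioo (0:ℝ) H) :
    ∃ Y : ℝ → Ω → ℝ,
      (∀ t : ℝ, 0 ≤ t → P {ω | X t ω = Y t ω} = 1) ∧
      ∀ ω : Ω, ContinuousOn (fun t => Y t ω) (Set.Ici 0) ∧
        ∀ T : ℝ, 0 < T → ∃ C : ℝ, ∀ s t : ℝ, 0 ≤ s → s < t → t ≤ T →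
          |Y t ω - Y s ω| ≤ C * (t - s) ^ γ := by
  classical
  have hr : (0 : ℝ) ≤ (1 / 2) ^ γ := by positivity
  have hr1 : ((1 : ℝ) / 2) ^ γ < 1 := Real.rpow_lt_one (by norm_num) (by norm_num) hγ.1
  obtain ⟨c, hc, hcb⟩ := exists_dyadic_tail_le P hH.1 hX hlaw hγ.2
  have hgood := ae_dyadicIncrementsLE hc hcb
  refine ⟨fun t ω => if DyadicIncrementsLE ((1 / 2) ^ γ) (fun t => X t ω)
    then dyadicLimit (fun t => X t ω) t else 0, fun t ht => ?_, fun ω => ?_⟩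
  · refine (measure_congr (eventuallyEq_univ.2 ?_)).trans measure_univ
    filter_upwards [hgood, ae_tendsto_dyadicFloor hr hr1 hc hcb ht] with ω hω hlim
    simp only [if_pos hω]
    exact tendsto_nhds_unique hlim (hω.tendsto_dyadicLimit hr hr1 ht)
  · refine (fun h => ⟨continuousOn_Ici_of_holder hγ.1 h, h⟩) fun T _ => ?_
    by_cases hω : DyadicIncrementsLE ((1 / 2) ^ γ) (fun t => X t ω)
    · simpa only [if_pos hω] using hω.exists_holder hγ.1 T
    · exact ⟨0, by simp only [if_neg hω]; simp⟩
end

section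
/- For every H ∈ (0,1), 1/(2H) + ∫₀^∞ ((x+1)^{H−1/2} − x^{H−1/2})² dx = Γ(H + 1/2)² / (Γ(2H + 1) · sin(πH)), where Γ denotes the Gamma function. Equivalently, the Mandelbrot–van Ness normalizing constant K_H^{MA} = (1/(2H) + ∫₀^∞ ((x+1)^{H−1/2} − x^{H−1/2})² dx)^{−1/2} equals (Γ(2H+1) sin(πH))^{1/2} / Γ(H + 1/2). -/
open Real MeasureTheory

open Set Filter Topology

/-- Euler's first-kind integral on `(0, 1)`, for real parameters. -/
lemma integral_beta_Ioo {p q : ℝ} (hp : 0 < p) (hq : 0 < q) :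
    IntegrableOn (fun t : ℝ ↦ t ^ (p - 1) * (1 - t) ^ (q - 1)) (Ioo 0 1) ∧
      ∫ t in Ioo (0 : ℝ) 1, t ^ (p - 1) * (1 - t) ^ (q - 1) =
        Real.Gamma p * Real.Gamma q / Real.Gamma (p + q) := by
  have hcongr : EqOn (fun t : ℝ ↦ (t : ℂ) ^ ((p : ℂ) - 1) * (1 - (t : ℂ)) ^ ((q : ℂ) - 1))
      (fun t : ℝ ↦ ((t ^ (p - 1) * (1 - t) ^ (q - 1) : ℝ) : ℂ)) (Ioo 0 1) := by
    intro t ht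
    have h1 : 0 ≤ 1 - t := sub_nonneg.2 ht.2.le
    simp only [Complex.ofReal_mul, Complex.ofReal_cpow ht.1.le, Complex.ofReal_cpow h1,
      Complex.ofReal_sub, Complex.ofReal_one]
  have hconv := Complex.betaIntegral_convergent (u := p) (v := q) (by simpa) (by simpa)
  rw [intervalIntegrable_iff_integrableOn_Ioo_of_le zero_le_one] at hconv
  have hint := (integrableOn_congr_fun hcongr measurableSet_Ioo).1 hconv
  refine ⟨by simpa [IntegrableOn] using hint.re, ?_⟩
  have hbeta := Complex.betaIntegral_eq_Gamma_mul_div p q (by simpa) (by simpa)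
  rw [Complex.betaIntegral, intervalIntegral.integral_of_le zero_le_one,
    integral_Ioc_eq_integral_Ioo, setIntegral_congr_fun measurableSet_Ioo hcongr,
    integral_complex_ofReal, ← Complex.ofReal_add, Complex.Gamma_ofReal, Complex.Gamma_ofReal,
    Complex.Gamma_ofReal] at hbeta
  exact_mod_cast hbeta

/-- Euler's first-kind integral in its form on `(0, ∞)`. -/
lemma integral_beta_Ioi {p q : ℝ} (hp : 0 < p) (hq : 0 < q) :
    IntegrableOn (fun x : ℝ ↦ x ^ (p - 1) * (x + 1) ^ (-(p + q))) (Ioi 0) ∧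
      ∫ x in Ioi (0 : ℝ), x ^ (p - 1) * (x + 1) ^ (-(p + q)) =
        Real.Gamma p * Real.Gamma q / Real.Gamma (p + q) := by
  have himage : (fun t : ℝ ↦ t / (1 - t)) '' Ioo 0 1 = Ioi 0 := by
    ext x
    constructor
    · rintro ⟨t, ht, rfl⟩
      exact div_pos ht.1 (sub_pos.2 ht.2)
    · intro hx
      have hx : 0 < x := hx
      refine ⟨x / (x + 1), ⟨by positivity, (div_lt_one (by positivity)).2 (by linarith)⟩, ?_⟩
      have : 1 - x / (x + 1) = 1 / (x + 1) := by field_simp; ring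
      simp only [this]
      field_simp
  have hderiv : ∀ t ∈ Ioo (0 : ℝ) 1,
      HasDerivWithinAt (fun t : ℝ ↦ t / (1 - t)) (1 / (1 - t) ^ 2) (Ioo 0 1) t := by
    intro t ht
    have h1 : (1 - t) ≠ 0 := (sub_pos.2 ht.2).ne'
    have := (hasDerivAt_id t).div ((hasDerivAt_id t).const_sub 1) h1
    refine (this.congr_deriv ?_).hasDerivWithinAt
    simp
  have hinj : InjOn (fun t : ℝ ↦ t / (1 - t)) (Ioo 0 1) := by
    intro s hs t ht hst
    have h1 : (1 - s) ≠ 0 := (sub_pos.2 hs.2).ne'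
    have h2 : (1 - t) ≠ 0 := (sub_pos.2 ht.2).ne'
    simp only [div_eq_div_iff h1 h2] at hst
    linarith
  have hcongr : EqOn (fun t : ℝ ↦ |1 / (1 - t) ^ 2| •
        ((t / (1 - t)) ^ (p - 1) * (t / (1 - t) + 1) ^ (-(p + q))))
      (fun t : ℝ ↦ t ^ (p - 1) * (1 - t) ^ (q - 1)) (Ioo 0 1) := by
    intro t ht
    have h1 : 0 < 1 - t := sub_pos.2 ht.2
    have h2 : t / (1 - t) + 1 = (1 - t)⁻¹ := by field_simp; ring
    have h3 : (1 - t) ^ (p + q) = (1 - t) ^ (q - 1) * (1 - t) ^ (p - 1) * (1 - t) ^ 2 := by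
      rw [← rpow_natCast, ← rpow_add h1, ← rpow_add h1]
      congr 1
      push_cast
      ring
    have h4 : (1 - t) ^ (p - 1) ≠ 0 := (rpow_pos_of_pos h1 _).ne'
    simp only [smul_eq_mul]
    rw [abs_of_pos (by positivity), h2, div_rpow ht.1.le h1.le, inv_rpow h1.le,
      rpow_neg h1.le, inv_inv, h3]
    field_simp
  have hbeta := integral_beta_Ioo hp hq
  rw [← himage, integrableOn_image_iff_integrableOn_abs_deriv_smul measurableSet_Ioo hderiv hinj,
    integral_image_eq_integral_abs_deriv_smul measurableSet_Ioo hderiv hinj,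
    integrableOn_congr_fun hcongr measurableSet_Ioo,
    setIntegral_congr_fun measurableSet_Ioo hcongr]
  exact hbeta

lemma abs_rpow_add_one_sub_rpow_le {a x : ℝ} (ha : |a| ≤ 1) (hx : 0 < x) :
    |(x + 1) ^ a - x ^ a| ≤ x ^ (a - 1) := by
  obtain ⟨c, hc, hslope⟩ := exists_hasDerivAt_eq_slope (fun y : ℝ ↦ y ^ a)
    (fun y ↦ a * y ^ (a - 1)) (lt_add_one x)
    (fun y hy ↦ (continuousAt_rpow_const _ _
      (Or.inl (hx.trans_le hy.1).ne')).continuousWithinAt)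
    (fun y hy ↦ hasDerivAt_rpow_const (Or.inl (hx.trans hy.1).ne'))
  simp only [add_sub_cancel_left, div_one] at hslope
  have hc0 : 0 < c := hx.trans hc.1
  rw [← hslope, abs_mul, abs_of_pos (rpow_pos_of_pos hc0 _)]
  have hle : c ^ (a - 1) ≤ x ^ (a - 1) :=
    rpow_le_rpow_of_nonpos hx hc.1.le (by linarith [(abs_le.1 ha).2])
  calc |a| * c ^ (a - 1) ≤ 1 * c ^ (a - 1) := by gcongr
    _ ≤ x ^ (a - 1) := by rwa [one_mul]

/-- The boundary term in the regularization of `∫ ((x + 1) ^ a - x ^ a) ^ 2`. -/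
noncomputable def incrementBoundary (a x : ℝ) : ℝ :=
  (x + 1) ^ (2 * a + 1) + x ^ (2 * a + 1) - 2 * (x ^ (a + 1) * (x + 1) ^ a) -
    x ^ (a + 1) * (x + 1) ^ (a - 1)

lemma hasDerivAt_incrementBoundary (a : ℝ) {x : ℝ} (hx : 0 < x) :
    HasDerivAt (incrementBoundary a)
      ((2 * a + 1) * ((x + 1) ^ a - x ^ a) ^ 2 - (1 - a) * (x ^ a * (x + 1) ^ (a - 2))) x := by
  have hx1 : 0 < x + 1 := by positivity
  have hpow (r : ℝ) : HasDerivAt (fun y : ℝ ↦ y ^ r) (r * x ^ (r - 1)) x :=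
    hasDerivAt_rpow_const (Or.inl hx.ne')
  have hpow1 (r : ℝ) : HasDerivAt (fun y : ℝ ↦ (y + 1) ^ r) (r * (x + 1) ^ (r - 1)) x := by
    simpa using ((hasDerivAt_id x).add_const 1).rpow_const (p := r) (Or.inl hx1.ne')
  have hderiv := (((hpow1 (2 * a + 1)).add (hpow (2 * a + 1))).sub
    (((hpow (a + 1)).mul (hpow1 a)).const_mul 2)).sub ((hpow (a + 1)).mul (hpow1 (a - 1)))
  refine hderiv.congr_deriv ?_
  have e1 : (x + 1) ^ a = (x + 1) ^ (a - 2) * (x + 1) ^ 2 := by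
    rw [← rpow_natCast, ← rpow_add hx1]; congr 1; push_cast; ring
  have e2 : (x + 1) ^ (a - 1) = (x + 1) ^ (a - 2) * (x + 1) := by
    rw [← rpow_add_one hx1.ne']; congr 1; ring
  have e3 : (x + 1) ^ (2 * a + 1 - 1) = (x + 1) ^ a * (x + 1) ^ a := by
    rw [← rpow_add hx1]; congr 1; ring
  have e4 : x ^ (2 * a + 1 - 1) = x ^ a * x ^ a := by
    rw [← rpow_add hx]; congr 1; ring
  have e5 : x ^ (a + 1) = x ^ a * x := rpow_add_one hx.ne' a
  have e6 : a - 1 - 1 = a - 2 := by ring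
  rw [e3, e4, e5, e6, add_sub_cancel_right, e2, e1]
  ring

lemma continuousAt_incrementBoundary_zero {a : ℝ} (ha : 0 < 2 * a + 1) :
    ContinuousAt (incrementBoundary a) 0 := by
  have hpow {r : ℝ} (hr : 0 < r) : ContinuousAt (fun y : ℝ ↦ y ^ r) 0 :=
    continuousAt_rpow_const _ _ (Or.inr hr.le)
  have hpow1 (r : ℝ) : ContinuousAt (fun y : ℝ ↦ (y + 1) ^ r) 0 :=
    (continuousAt_id.add continuousAt_const).rpow_const (Or.inl (by simp))
  have ha1 : 0 < a + 1 := by linarith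
  exact (((hpow1 _).add (hpow ha)).sub (((hpow ha1).mul (hpow1 a)).const_mul 2)).sub
    ((hpow ha1).mul (hpow1 (a - 1)))

lemma incrementBoundary_zero {a : ℝ} (ha : 0 < 2 * a + 1) : incrementBoundary a 0 = 1 := by
  have ha1 : a + 1 ≠ 0 := by linarith
  simp [incrementBoundary, zero_rpow ha.ne', zero_rpow ha1]

lemma tendsto_incrementBoundary_atTop {a : ℝ} (ha : |a| < 1 / 2) :
    Tendsto (incrementBoundary a) atTop (𝓝 0) := by
  have ha1 : |a| ≤ 1 := by linarith
  have hlim : Tendsto (fun x : ℝ ↦ 5 * x ^ (-(1 - 2 * a))) atTop (𝓝 0) := by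
    simpa using (tendsto_rpow_neg_atTop
      (by linarith [(abs_lt.1 ha).2] : 0 < 1 - 2 * a)).const_mul 5
  refine squeeze_zero_norm' ?_ hlim
  filter_upwards [eventually_ge_atTop 1] with x hx
  have hx0 : 0 < x := by linarith
  have hx1 : 0 < x + 1 := by linarith
  have e1 : (x + 1) ^ (2 * a + 1) = (x + 1) ^ a * (x + 1) ^ a * (x + 1) := by
    rw [← rpow_add hx1, ← rpow_add_one hx1.ne']; congr 1; ring
  have e2 : x ^ (2 * a + 1) = x ^ a * x ^ a * x := by
    rw [← rpow_add hx0, ← rpow_add_one hx0.ne']; congr 1; ring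
  have e3 : x ^ (a + 1) = x ^ a * x := rpow_add_one hx0.ne' a
  have e4 : (x + 1) ^ (a - 1) = (x + 1) ^ a / (x + 1) := rpow_sub_one hx1.ne' a
  have e5 : x ^ (-(1 - 2 * a)) = x ^ (a - 1) * x ^ (a - 1) * x := by
    rw [← rpow_add hx0, ← rpow_add_one hx0.ne']; congr 1; ring
  have e6 : x ^ a = x ^ (a - 1) * x := by
    rw [← rpow_add_one hx0.ne']; congr 1; ring
  have hd := abs_rpow_add_one_sub_rpow_le ha1 hx0
  set A := (x + 1) ^ a
  set D := x ^ (a - 1)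
  have hA : 0 < A := rpow_pos_of_pos hx1 _
  have hD : 0 < D := rpow_pos_of_pos hx0 _
  have hsplit : incrementBoundary a x =
      x * (A - x ^ a) ^ 2 + A * (A - x ^ a) + A * x ^ a / (x + 1) := by
    rw [incrementBoundary, e1, e2, e3, e4]
    field_simp
    ring
  rw [e6] at hd hsplit
  have hA2 : A ≤ 2 * (D * x) := by nlinarith [(abs_le.1 hd).2]
  have b1 : |x * (A - D * x) ^ 2| ≤ D * D * x := by
    rw [abs_mul, abs_of_pos hx0, abs_pow]
    calc x * |A - D * x| ^ 2 ≤ x * D ^ 2 := by gcongr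
      _ = D * D * x := by ring
  have b2 : |A * (A - D * x)| ≤ 2 * (D * D * x) := by
    rw [abs_mul, abs_of_pos hA]
    calc A * |A - D * x| ≤ 2 * (D * x) * D := by gcongr
      _ = 2 * (D * D * x) := by ring
  have b3 : |A * (D * x) / (x + 1)| ≤ 2 * (D * D * x) := by
    rw [abs_of_pos (by positivity), div_le_iff₀ hx1]
    calc A * (D * x) ≤ 2 * (D * x) * (D * x) := by gcongr
      _ ≤ 2 * (D * D * x) * (x + 1) := by nlinarith [mul_pos (mul_pos hD hD) hx0]
  rw [norm_eq_abs, hsplit, e5]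
  linarith [abs_add_three (x * (A - D * x) ^ 2) (A * (A - D * x)) (A * (D * x) / (x + 1))]

/-- The integral of the squared increment of a power, as a convergent beta integral. -/
lemma integral_sq_rpow_increment {a : ℝ} (ha : |a| < 1 / 2) :
    1 + (2 * a + 1) * ∫ x in Ioi (0 : ℝ), ((x + 1) ^ a - x ^ a) ^ 2 =
      (1 - a) * ∫ x in Ioi (0 : ℝ), x ^ a * (x + 1) ^ (a - 2) := by
  obtain ⟨hal, har⟩ := abs_lt.1 ha
  have hpos : 0 < 2 * a + 1 := by linarith
  have hk : IntegrableOn (fun x : ℝ ↦ x ^ a * (x + 1) ^ (a - 2)) (Ioi 0) := by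
    convert (integral_beta_Ioi (p := a + 1) (q := 1 - 2 * a) (by linarith) (by linarith)).1
      using 4 <;> ring
  set k : ℝ → ℝ := fun x ↦ x ^ a * (x + 1) ^ (a - 2)
  have hi : Integrable ((Ioi 0).indicator k) := hk.integrable_indicator measurableSet_Ioi
  set P : ℝ → ℝ := fun u ↦ ∫ x in (0 : ℝ)..u, (Ioi 0).indicator k x
  have hPcont : Continuous P := hi.continuous_primitive 0
  have hPlim : Tendsto P atTop (𝓝 (∫ x in Ioi 0, k x)) := by
    have := intervalIntegral_tendsto_integral_Ioi 0 hi.integrableOn tendsto_id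
    rwa [setIntegral_indicator measurableSet_Ioi, inter_self] at this
  have hPderiv (x : ℝ) (hx : x ∈ Ioi 0) : HasDerivAt P (k x) x := by
    have hx0 : 0 < x := hx
    have hx1 : x + 1 ≠ 0 := by linarith
    have hkc : ContinuousAt k x := (continuousAt_rpow_const _ _ (Or.inl hx0.ne')).mul
      ((continuousAt_id.add continuousAt_const).rpow_const (Or.inl hx1))
    have hic : ContinuousAt ((Ioi 0).indicator k) x :=
      hkc.congr ((eventually_mem_set.2 (Ioi_mem_nhds hx0)).mono
        fun y hy ↦ (indicator_of_mem hy k).symm)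
    have := intervalIntegral.integral_hasDerivAt_right (hi.intervalIntegrable (a := 0))
      hi.aestronglyMeasurable.stronglyMeasurableAtFilter hic
    rwa [indicator_of_mem hx] at this
  have key := integral_Ioi_of_hasDerivAt_of_nonneg (a := 0)
    (g := fun x ↦ incrementBoundary a x + (1 - a) * P x)
    (g' := fun x ↦ (2 * a + 1) * ((x + 1) ^ a - x ^ a) ^ 2)
    ((continuousAt_incrementBoundary_zero hpos).add
      (hPcont.continuousAt.const_mul _)).continuousWithinAt
    (fun x hx ↦ ((hasDerivAt_incrementBoundary a hx).add
      ((hPderiv x hx).const_mul (1 - a))).congr_deriv (by ring))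
    (fun x _ ↦ by positivity)
    ((tendsto_incrementBoundary_atTop ha).add (hPlim.const_mul (1 - a)))
  rw [integral_const_mul, incrementBoundary_zero hpos] at key
  have hP0 : P 0 = 0 := intervalIntegral.integral_same
  rw [key, hP0]
  ring

/-- A combination of the duplication and reflection formulas for the Gamma function. -/
lemma Gamma_two_sub_mul_Gamma_mul_sin {H : ℝ} (hH : H ∈ Ioo (0 : ℝ) 1) :
    Real.Gamma (2 - 2 * H) * Real.Gamma (2 * H) * Real.sin (π * H) =
      Real.Gamma (3 / 2 - H) * Real.Gamma (H + 1 / 2) := by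
  have hsin : 0 < Real.sin (π * H) :=
    sin_pos_of_pos_of_lt_pi (mul_pos pi_pos hH.1) (by nlinarith [pi_pos, hH.2])
  have h1 := Real.Gamma_mul_Gamma_add_half H
  have h2 := Real.Gamma_mul_Gamma_add_half (1 - H)
  have h3 := Real.Gamma_mul_Gamma_one_sub H
  rw [show 1 - H + 1 / 2 = 3 / 2 - H by ring, show 2 * (1 - H) = 2 - 2 * H by ring,
    show 1 - (2 - 2 * H) = -(1 - 2 * H) by ring, rpow_neg zero_le_two] at h2
  rw [eq_div_iff hsin.ne'] at h3
  have h4 : (2 : ℝ) ^ (1 - 2 * H) ≠ 0 := (rpow_pos_of_pos two_pos _).ne'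
  have h5 : √π * √π = π := mul_self_sqrt pi_pos.le
  have h6 : Real.Gamma H * Real.Gamma (1 - H) *
      (Real.Gamma (3 / 2 - H) * Real.Gamma (H + 1 / 2)) =
      Real.Gamma (2 - 2 * H) * Real.Gamma (2 * H) * π := by
    calc _ = (Real.Gamma H * Real.Gamma (H + 1 / 2)) *
          (Real.Gamma (1 - H) * Real.Gamma (3 / 2 - H)) := by ring
      _ = Real.Gamma (2 - 2 * H) * Real.Gamma (2 * H) * (√π * √π) := by
        rw [h1, h2]; field_simp
      _ = _ := by rw [h5]
  apply mul_left_cancel₀ pi_ne_zero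
  linear_combination -Real.sin (π * H) * h6 +
    Real.Gamma (3 / 2 - H) * Real.Gamma (H + 1 / 2) * h3

/-- The value of the Mandelbrot–van Ness normalizing constant:
`1/(2H) + ∫₀^∞ ((x+1)^(H-1/2) - x^(H-1/2))² dx = Γ(H+1/2)² / (Γ(2H+1) sin(πH))`. -/
theorem mandelbrot_van_ness_constant (H : ℝ) (hH : H ∈ Set.Ioo (0:ℝ) 1) :
    1/(2*H) + (∫ x in Set.Ioi (0:ℝ), ((x+1) ^ (H - 1/2) - x ^ (H - 1/2)) ^ 2) =
      Real.Gamma (H + 1/2) ^ 2 / (Real.Gamma (2*H + 1) * Real.sin (π * H)) := by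
  obtain ⟨h0, h1⟩ := hH
  have hint := integral_sq_rpow_increment (a := H - 1 / 2)
    (abs_lt.2 ⟨by linarith, by linarith⟩)
  have hbeta := (integral_beta_Ioi (p := H + 1 / 2) (q := 2 - 2 * H)
    (by linarith) (by linarith)).2
  rw [show H + 1 / 2 - 1 = H - 1 / 2 by ring,
    show -(H + 1 / 2 + (2 - 2 * H)) = H - 1 / 2 - 2 by ring,
    show H + 1 / 2 + (2 - 2 * H) = 3 / 2 - H + 1 by ring,
    Real.Gamma_add_one (by linarith)] at hbeta
  rw [hbeta, show 2 * (H - 1 / 2) + 1 = 2 * H by ring,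
    show 1 - (H - 1 / 2) = 3 / 2 - H by ring] at hint
  have hsin : 0 < Real.sin (π * H) :=
    sin_pos_of_pos_of_lt_pi (mul_pos pi_pos h0) (by nlinarith [pi_pos])
  have hG1 : 0 < Real.Gamma (2 * H) := Real.Gamma_pos_of_pos (by linarith)
  have hG2 : 0 < Real.Gamma (3 / 2 - H) := Real.Gamma_pos_of_pos (by linarith)
  have h32 : 3 / 2 - H ≠ 0 := by linarith
  have hrefl := Gamma_two_sub_mul_Gamma_mul_sin ⟨h0, h1⟩
  rw [Real.Gamma_add_one (by linarith)]
  set I := ∫ x in Set.Ioi (0:ℝ), ((x+1) ^ (H - 1/2) - x ^ (H - 1/2)) ^ 2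
  have hval : (1 + 2 * H * I) * Real.Gamma (3 / 2 - H) =
      Real.Gamma (H + 1 / 2) * Real.Gamma (2 - 2 * H) := by
    rw [hint, ← mul_div_assoc, mul_div_mul_left _ _ h32, div_mul_cancel₀ _ hG2.ne']
  rw [eq_div_iff (by positivity)]
  apply mul_left_cancel₀ hG2.ne'
  have hI : (1 / (2 * H) + I) * (2 * H) = 1 + 2 * H * I := by field_simp
  linear_combination Real.Gamma (3 / 2 - H) * Real.Gamma (2 * H) * Real.sin (π * H) * hI +
    Real.Gamma (2 * H) * Real.sin (π * H) * hval + Real.Gamma (H + 1 / 2) * hrefl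
end
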